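/- Let (p₀,p₁,p₂,p₃) be a piecewise polynomial vector field of degree ≤ 2 on the Alfeld split T^z of a tetrahedron T ⊂ ℝ³ which is continuous across interior faces (p_i = p_j at every point of F_{ij} for all i ≠ j) and is C¹ at every vertex of T^z (for every a ∈ {x₀,x₁,x₂,x₃,z} and all i, j with a ∈ T_i ∩ T_j, Dp_i(a) = Dp_j(a)). Then all the pieces coincide: p₀ = p₁ = p₂ = p₃, i.e. the field is a single polynomial map of degree ≤ 2 on T. -/

import Mathlib

open MvPolynomial Matrix

noncomputable section

namespace Alfeld

abbrev V3 : Type := Fin 3 → ℝ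
abbrev P3 : Type := MvPolynomial (Fin 3) ℝ
abbrev VP3 : Type := Fin 3 → P3

/-- Cross product of vectors in `ℝ³`. -/
def cross3 (u v : V3) : V3 := fun c => u (c + 1) * v (c + 2) - u (c + 2) * v (c + 1)

/-- Evaluation of a polynomial vector field at a point. -/
def evalV (p : VP3) (y : V3) : V3 := fun c => eval y (p c)

/-- Gradient of a polynomial. -/
def pgrad (q : P3) : VP3 := fun c => pderiv c q

/-- Curl of a polynomial vector field. -/
def pcurl (p : VP3) : VP3 := fun c => pderiv (c + 1) (p (c + 2)) - pderiv (c + 2) (p (c + 1))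

/-- Divergence of a polynomial vector field. -/
def pdiv (p : VP3) : P3 := ∑ c, pderiv c (p c)

/-- Cross product of polynomial vector fields. -/
def pcross (u v : VP3) : VP3 := fun c => u (c + 1) * v (c + 2) - u (c + 2) * v (c + 1)

/-- All components have total degree at most `r`. -/
def degVle (p : VP3) (r : ℕ) : Prop := ∀ c, (p c).totalDegree ≤ r

/-- Barycenter of the tetrahedron with vertices `x 0, x 1, x 2, x 3`. -/
def bary (x : Fin 4 → V3) : V3 := (4 : ℝ)⁻¹ • (x 0 + x 1 + x 2 + x 3)

/-- The piece `T_i` of the Alfeld split. -/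
def piece (x : Fin 4 → V3) (i : Fin 4) : Set V3 :=
  convexHull ℝ (insert (bary x) (x '' {j | j ≠ i}))

/-- The interior face `F_{ij} = T_i ∩ T_j`. -/
def intFace (x : Fin 4 → V3) (i j : Fin 4) : Set V3 :=
  convexHull ℝ (insert (bary x) (x '' {k | k ≠ i ∧ k ≠ j}))

/-- The boundary face of `T` opposite the vertex `x i`. -/
def bdryFace (x : Fin 4 → V3) (i : Fin 4) : Set V3 :=
  convexHull ℝ (x '' {j | j ≠ i})

/-- `n` is a (Euclidean) unit normal of the interior face `F_{ij}`. -/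
def IsUnitNormalInt (x : Fin 4 → V3) (i j : Fin 4) (n : V3) : Prop :=
  n ⬝ᵥ n = 1 ∧ ∀ k, k ≠ i → k ≠ j → n ⬝ᵥ (x k - bary x) = 0

/-- `n` is a (Euclidean) unit normal of the boundary face `F_i`. -/
def IsUnitNormalBdry (x : Fin 4 → V3) (i : Fin 4) (n : V3) : Prop :=
  n ⬝ᵥ n = 1 ∧ ∀ j k, j ≠ i → k ≠ i → n ⬝ᵥ (x k - x j) = 0

/-- The vertices of the Alfeld split. -/
def vertices (x : Fin 4 → V3) : Set V3 := insert (bary x) (Set.range x)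

/-- Jacobian matrix of a polynomial vector field at a point. -/
def jacob (p : VP3) (a : V3) : Fin 3 → Fin 3 → ℝ := fun c d => eval a (pderiv d (p c))

end Alfeld

open Alfeld

namespace Alfeld

/-- The constant coefficients of the second partial derivatives of a polynomial. -/
def hessian (q : P3) : Matrix (Fin 3) (Fin 3) ℝ :=
  fun d e => coeff 0 (pderiv e (pderiv d q))

theorem coeff_zero_pderiv (q : P3) (i : Fin 3) :
    coeff 0 (pderiv i q) = coeff (Finsupp.single i 1) q := by
  simp [coeff_pderiv]

theorem hessian_isSymm (q : P3) : (hessian q).IsSymm := by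
  ext d e
  simp only [Matrix.transpose_apply, hessian, coeff_pderiv, zero_add]
  rcases eq_or_ne d e with rfl | h
  · rfl
  · rw [add_comm (Finsupp.single d 1)]
    simp [h, h.symm]

theorem hessian_add (q r : P3) : hessian (q + r) = hessian q + hessian r := by
  ext d e
  simp [hessian]

theorem totalDegree_pderiv_le {q : P3} {n : ℕ} (hq : q.totalDegree ≤ n + 1) (i : Fin 3) :
    (pderiv i q).totalDegree ≤ n := by
  refine Finset.sup_le fun m hm => ?_
  rw [mem_support_iff, coeff_pderiv] at hm
  have h := (le_totalDegree (mem_support_iff.mpr (left_ne_zero_of_mul hm))).trans hq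
  rw [Finsupp.sum_add_index' (fun _ => rfl) fun _ _ _ => rfl, Finsupp.sum_single_index rfl] at h
  exact Nat.le_of_succ_le_succ h

theorem eq_affine_of_totalDegree_le_one {r : P3} (hr : r.totalDegree ≤ 1) :
    r = C (coeff 0 r) + ∑ i, C (coeff (Finsupp.single i 1) r) * X i := by
  classical
  ext m
  simp only [coeff_add, coeff_C, coeff_sum, coeff_C_mul, coeff_X]
  by_cases h0 : m = 0
  · simp [h0]
  by_cases h1 : ∃ i, Finsupp.single i 1 = m
  · obtain ⟨i, rfl⟩ := h1
    simp [Finsupp.single_left_inj, Ne.symm h0]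
  · have hm : coeff m r = 0 := by
      by_contra hne
      have hle : m.degree ≤ 1 := (le_totalDegree (mem_support_iff.mpr hne)).trans hr
      obtain ⟨i, hi⟩ := Finsupp.ne_iff.mp h0
      have hsingle : Finsupp.single i 1 ≤ m := by
        simpa [Finsupp.single_le_iff, Nat.one_le_iff_ne_zero] using hi
      obtain ⟨n, rfl⟩ := exists_add_of_le hsingle
      rw [map_add, Finsupp.degree_single, add_le_iff_nonpos_right, nonpos_iff_eq_zero,
        Finsupp.degree_eq_zero_iff] at hle
      exact h1 ⟨i, by rw [hle, add_zero]⟩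
    simp [hm, Ne.symm h0, not_exists.mp h1]

theorem eval_eq_of_totalDegree_le_one {r : P3} (hr : r.totalDegree ≤ 1) (y : V3) :
    eval y r = coeff 0 r + ∑ i, coeff 0 (pderiv i r) * y i := by
  conv_lhs => rw [eq_affine_of_totalDegree_le_one hr]
  simp [coeff_zero_pderiv]

theorem eval_pderiv_sub {q : P3} (hq : q.totalDegree ≤ 2) (y z : V3) (d : Fin 3) :
    eval y (pderiv d q) - eval z (pderiv d q) = (hessian q *ᵥ (y - z)) d := by
  have h := eval_eq_of_totalDegree_le_one (totalDegree_pderiv_le hq d)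
  rw [h y, h z, add_sub_add_left_eq_sub, ← Finset.sum_sub_distrib]
  simp only [← mul_sub]
  rfl

theorem eq_zero_of_pderiv_eq_zero {q : P3} (hd : ∀ d, pderiv d q = 0) {z : V3}
    (hz : eval z q = 0) : q = 0 := by
  have hC : q = C (coeff 0 q) := by
    ext m
    rw [coeff_C]
    split_ifs with hm
    · rw [hm]
    · obtain ⟨d, hmd⟩ := Finsupp.ne_iff.mp (Ne.symm hm)
      have h := congrArg (coeff (m - Finsupp.single d 1)) (hd d)
      have hle : Finsupp.single d 1 ≤ m := by
        simpa [Finsupp.single_le_iff, Nat.one_le_iff_ne_zero] using hmd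
      rw [coeff_pderiv, tsub_add_cancel_of_le hle, coeff_zero] at h
      exact (mul_eq_zero.mp h).resolve_right (by positivity)
  rw [hC, eval_C] at hz
  rw [hC, hz, C_0]

theorem sum_sub_bary (x : Fin 4 → V3) : ∑ m, (x m - bary x) = 0 := by
  ext c
  simp [Fin.sum_univ_four, bary]

theorem eq_zero_of_dotProduct_sub_bary {x : Fin 4 → V3} (hx : AffineIndependent ℝ x) {w : V3}
    (hw : ∀ m, w ⬝ᵥ (x m - bary x) = 0) : w = 0 := by
  have hspan : vectorSpan ℝ (Set.range x) = ⊤ :=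
    hx.vectorSpan_eq_top_of_card_eq_finrank_add_one (by simp)
  have key : ∀ v ∈ vectorSpan ℝ (Set.range x), w ⬝ᵥ v = 0 := by
    intro v hv
    rw [vectorSpan_def] at hv
    induction hv using Submodule.span_induction with
    | mem v hv =>
      obtain ⟨_, ⟨m, rfl⟩, _, ⟨n, rfl⟩, rfl⟩ := hv
      have h : x m -ᵥ x n = (x m - bary x) - (x n - bary x) := by simp
      simp only [h, dotProduct_sub, hw, sub_zero]
    | zero => simp
    | add u v _ _ hu hv => rw [dotProduct_add, hu, hv, add_zero]
    | smul a v _ hv => rw [dotProduct_smul, hv, smul_zero]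
  exact dotProduct_self_eq_zero.mp (key w (hspan ▸ Submodule.mem_top))

theorem eq_zero_of_mulVec_sub_bary {x : Fin 4 → V3} (hx : AffineIndependent ℝ x)
    {A : Matrix (Fin 3) (Fin 3) ℝ} (hA : ∀ m, A *ᵥ (x m - bary x) = 0) : A = 0 := by
  ext d e
  exact congrFun (eq_zero_of_dotProduct_sub_bary hx fun m => congrFun (hA m) d) e

theorem dotProduct_mulVec_comm_of_isSymm {A : Matrix (Fin 3) (Fin 3) ℝ} (hA : A.IsSymm)
    (u v : V3) : u ⬝ᵥ A *ᵥ v = v ⬝ᵥ A *ᵥ u := by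
  rw [dotProduct_mulVec, ← mulVec_transpose, hA.eq, dotProduct_comm]

/-- Three symmetric matrices `A`, `B`, `C` with zero sum vanish if their kernels contain the edges
of the interior faces `F_{ij}`, `F_{jk}`, `F_{ki}` respectively. -/
theorem eq_zero_of_cycle {x : Fin 4 → V3} (hx : AffineIndependent ℝ x)
    {A B C : Matrix (Fin 3) (Fin 3) ℝ} (hA : A.IsSymm) (hC : C.IsSymm) (hsum : A + B + C = 0)
    {i j : Fin 4} (hij : i ≠ j)
    (hAe : ∀ m, m ≠ i → m ≠ j → A *ᵥ (x m - bary x) = 0)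
    (hBe : B *ᵥ (x i - bary x) = 0) (hCe : C *ᵥ (x j - bary x) = 0) : A = 0 := by
  have hAsum : A *ᵥ (x i - bary x) + A *ᵥ (x j - bary x) = 0 := by
    rw [← Finset.sum_pair (f := fun m => A *ᵥ (x m - bary x)) hij,
      Finset.sum_subset (Finset.subset_univ _) fun m _ hm => by
        simp only [Finset.mem_insert, Finset.mem_singleton, not_or] at hm
        exact hAe m hm.1 hm.2,
      ← Matrix.mulVec_sum, sum_sub_bary, mulVec_zero]
  have hj : (x j - bary x) ⬝ᵥ A *ᵥ (x i - bary x) = 0 := by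
    have h : (x j - bary x) ⬝ᵥ (A + B + C) *ᵥ (x i - bary x) = 0 := by simp [hsum]
    rwa [add_mulVec, add_mulVec, hBe, add_zero, dotProduct_add,
      dotProduct_mulVec_comm_of_isSymm hC, hCe, dotProduct_zero, add_zero] at h
  have hi : A *ᵥ (x i - bary x) = 0 := by
    refine eq_zero_of_dotProduct_sub_bary hx fun m => ?_
    rw [dotProduct_comm]
    rcases eq_or_ne m j with rfl | hmj
    · exact hj
    rcases eq_or_ne m i with rfl | hmi
    · rw [eq_neg_of_add_eq_zero_left hAsum, dotProduct_neg,
        dotProduct_mulVec_comm_of_isSymm hA, hj, neg_zero]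
    · rw [dotProduct_mulVec_comm_of_isSymm hA, hAe m hmi hmj, dotProduct_zero]
  refine eq_zero_of_mulVec_sub_bary hx fun m => ?_
  rcases eq_or_ne m i with rfl | hmi
  · exact hi
  rcases eq_or_ne m j with rfl | hmj
  · rwa [hi, zero_add] at hAsum
  · exact hAe m hmi hmj

theorem bary_mem_piece (x : Fin 4 → V3) (i : Fin 4) : bary x ∈ piece x i :=
  subset_convexHull ℝ _ (Set.mem_insert _ _)

theorem bary_mem_intFace (x : Fin 4 → V3) (i j : Fin 4) : bary x ∈ intFace x i j :=
  subset_convexHull ℝ _ (Set.mem_insert _ _)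

theorem vertex_mem_piece (x : Fin 4 → V3) {i m : Fin 4} (h : m ≠ i) : x m ∈ piece x i :=
  subset_convexHull ℝ _ (Set.mem_insert_of_mem _ (Set.mem_image_of_mem x h))

end Alfeld

/-- a continuous piecewise quadratic vector field on an Alfeld split which is
`C¹` at all vertices is a single polynomial. -/
theorem statement10 (x : Fin 4 → V3) (hx : AffineIndependent ℝ x)
    (p : Fin 4 → VP3) (hdeg : ∀ i, degVle (p i) 2)
    (hcont : ∀ i j, i ≠ j → ∀ y ∈ intFace x i j, evalV (p i) y = evalV (p j) y)
    (hC1 : ∀ a ∈ vertices x, ∀ i j, a ∈ piece x i → a ∈ piece x j →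
      jacob (p i) a = jacob (p j) a) :
    ∀ i j, p i = p j := by
  intro i j
  rcases eq_or_ne i j with rfl | hij
  · rfl
  obtain ⟨k, hki, hkj⟩ : ∃ k : Fin 4, k ≠ i ∧ k ≠ j := by
    decide +revert
  ext1 c
  have hdeg' : ∀ a b, (p a c - p b c).totalDegree ≤ 2 := fun a b =>
    (totalDegree_sub _ _).trans (max_le (hdeg a c) (hdeg b c))
  have hz : ∀ a b d, eval (bary x) (pderiv d (p a c - p b c)) = 0 := fun a b d => by
    have h := congrFun (congrFun (hC1 _ (Set.mem_insert _ _) a b (bary_mem_piece x a)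
      (bary_mem_piece x b)) c) d
    rw [map_sub, map_sub, sub_eq_zero]
    exact h
  have hker : ∀ a b m, m ≠ a → m ≠ b →
      hessian (p a c - p b c) *ᵥ (x m - bary x) = 0 := fun a b m ha hb => by
    ext d
    have h := congrFun (congrFun (hC1 (x m) (Set.mem_insert_of_mem _ (Set.mem_range_self m)) a b
      (vertex_mem_piece x ha) (vertex_mem_piece x hb)) c) d
    rw [← eval_pderiv_sub (hdeg' a b), hz, sub_zero, map_sub, map_sub, Pi.zero_apply, sub_eq_zero]
    exact h
  have hsum : hessian (p i c - p j c) + hessian (p j c - p k c) + hessian (p k c - p i c) = 0 := by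
    rw [← hessian_add, ← hessian_add, sub_add_sub_cancel, sub_add_sub_cancel, sub_self]
    ext d e
    simp [hessian]
  have hH : hessian (p i c - p j c) = 0 :=
    eq_zero_of_cycle hx (hessian_isSymm _) (hessian_isSymm _) hsum hij (hker i j)
      (hker j k i hij hki.symm) (hker k i j hkj.symm hij.symm)
  refine sub_eq_zero.mp (eq_zero_of_pderiv_eq_zero (z := bary x) (fun d => ?_) ?_)
  · refine MvPolynomial.funext fun y => ?_
    have h := eval_pderiv_sub (hdeg' i j) y (bary x) d
    rwa [hz, sub_zero, hH, zero_mulVec, Pi.zero_apply, ← map_zero (eval y)] at h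
  · rw [map_sub, sub_eq_zero]
    exact congrFun (hcont i j hij _ (bary_mem_intFace x i j)) c
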